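/- arXiv:2602.05957 — 7 statements merged into one kernel-verified Lean document; each statement's English description precedes it below -/
import Mathlib

section
/- Let v₁, v₂ ∈ ℤ² be linearly independent vectors. Then there exist a 2×2 integer matrix M with determinant 1 or −1, and integers c, d with 0 ≤ c < d, such that the image under x ↦ M·x of cone(v₁, v₂) equals cone((1,0), (c,d)). -/
/-- The cone generated by two vectors `u, v` in `ℝ²`:
all combinations `s • u + t • v` with `s, t ≥ 0`. -/
def cone (u v : Fin 2 → ℝ) : Set (Fin 2 → ℝ) :=
  {x | ∃ s t : ℝ, 0 ≤ s ∧ 0 ≤ t ∧ x = s • u + t • v}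

theorem cone_arith (a b e f : ℤ) (hD : a * f - b * e ≠ 0) :
    ∃ p q r s g c d : ℤ, (p * s - q * r = 1 ∨ p * s - q * r = -1) ∧ 0 < g ∧ 0 ≤ c ∧ c < d ∧
      p * a + q * b = g ∧ r * a + s * b = 0 ∧ p * e + q * f = c ∧ r * e + s * f = d := by
  have hg : 0 < (Int.gcd a b : ℤ) := by
    have : Int.gcd a b ≠ 0 := by
      intro h0
      rw [Int.gcd_eq_zero_iff] at h0
      apply hD
      simp [h0.1, h0.2]
    omega
  have hbez := Int.gcd_eq_gcd_ab a b
  obtain ⟨a', ha⟩ := Int.gcd_dvd_left a b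
  obtain ⟨b', hb⟩ := Int.gcd_dvd_right a b
  generalize (Int.gcd a b : ℤ) = g at *
  generalize Int.gcdA a b = p at *
  generalize Int.gcdB a b = q at *
  have h1 : p * a' + q * b' = 1 := by
    apply mul_left_cancel₀ hg.ne'
    linear_combination -hbez - p * ha - q * hb
  have hy : -b' * e + a' * f ≠ 0 := by
    intro h0
    apply hD
    linear_combination f * ha - e * hb + g * h0
  obtain ⟨ε, hε, hpos⟩ : ∃ ε : ℤ, (ε = 1 ∨ ε = -1) ∧ 0 < ε * (-b' * e + a' * f) := by
    rcases lt_or_gt_of_ne hy with h | h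
    · exact ⟨-1, Or.inr rfl, by linarith⟩
    · exact ⟨1, Or.inl rfl, by linarith⟩
  set d := ε * (-b' * e + a' * f) with hd
  have hk := Int.emod_add_mul_ediv (p * e + q * f) d
  have hdet : ∀ k : ℤ, (p + k * ε * b') * (ε * a') - (q - k * ε * a') * (-ε * b') = ε := by
    intro k
    linear_combination ε * h1
  refine ⟨p + (p * e + q * f) / d * ε * b', q - (p * e + q * f) / d * ε * a', -ε * b', ε * a', g,
    (p * e + q * f) % d, d, ?_, hg, Int.emod_nonneg _ hpos.ne', Int.emod_lt_of_pos _ hpos,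
    ?_, ?_, ?_, ?_⟩
  · rw [hdet]
    exact hε
  · generalize (p * e + q * f) / d = k
    linear_combination (k * ε * b') * ha - (k * ε * a') * hb - hbez
  · linear_combination (-ε * b') * ha + (ε * a') * hb
  · generalize (p * e + q * f) / d = k at *
    linear_combination -hk + k * hd
  · rw [hd]
    ring

theorem stmt3 (v₁ v₂ : Fin 2 → ℤ) (h : LinearIndependent ℤ ![v₁, v₂]) :
    ∃ (M : Matrix (Fin 2) (Fin 2) ℤ) (c d : ℤ),
      (M.det = 1 ∨ M.det = -1) ∧ 0 ≤ c ∧ c < d ∧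
      (fun x => (M.map (fun z => (z : ℝ))).mulVec x) ''
          cone (fun i => (v₁ i : ℝ)) (fun i => (v₂ i : ℝ)) =
        cone ![(1 : ℝ), 0] ![(c : ℝ), (d : ℝ)] := by
  have hD : v₁ 0 * v₂ 1 - v₁ 1 * v₂ 0 ≠ 0 := by
    intro h0
    rw [LinearIndependent.pair_iff] at h
    have h1 := h (v₂ 1) (-v₁ 1) (by
      ext i; fin_cases i
      · simp; linarith
      · simp; ring)
    have h2 := h (v₂ 0) (-v₁ 0) (by
      ext i; fin_cases i
      · simp; ring
      · simp; linarith)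
    have h3 := h 1 0 (by
      ext i; fin_cases i
      · simp; linarith [h2.2]
      · simp; linarith [h1.2])
    exact one_ne_zero h3.1
  obtain ⟨p, q, r, s, g, c, d, hdet, hg, hc, hcd, e1, e2, e3, e4⟩ :=
    cone_arith _ _ _ _ hD
  refine ⟨!![p, q; r, s], c, d, by simpa [Matrix.det_fin_two] using hdet, hc, hcd, ?_⟩
  have hg' : (0 : ℝ) < g := by exact_mod_cast hg
  have E1 : (p * v₁ 0 + q * v₁ 1 : ℝ) = g := by exact_mod_cast e1
  have E2 : (r * v₁ 0 + s * v₁ 1 : ℝ) = 0 := by exact_mod_cast e2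
  have E3 : (p * v₂ 0 + q * v₂ 1 : ℝ) = c := by exact_mod_cast e3
  have E4 : (r * v₂ 0 + s * v₂ 1 : ℝ) = d := by exact_mod_cast e4
  have key : ∀ x y : ℝ, (!![p, q; r, s].map (fun z : ℤ => (z : ℝ))).mulVec
      (x • (fun i => (v₁ i : ℝ)) + y • (fun i => (v₂ i : ℝ))) =
      (x * g) • ![(1 : ℝ), 0] + y • ![(c : ℝ), (d : ℝ)] := by
    intro x y
    ext i; fin_cases i
    · simp [Matrix.mulVec, dotProduct, Fin.sum_univ_two]
      linear_combination x * E1 + y * E3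
    · simp [Matrix.mulVec, dotProduct, Fin.sum_univ_two]
      linear_combination x * E2 + y * E4
  ext z
  constructor
  · rintro ⟨_, ⟨x, y, hx, hy, rfl⟩, rfl⟩
    exact ⟨x * g, y, by positivity, hy, key x y⟩
  · rintro ⟨x, y, hx, hy, rfl⟩
    refine ⟨_, ⟨x / g, y, by positivity, hy, rfl⟩, ?_⟩
    have := key (x / g) y
    rw [div_mul_cancel₀ _ hg'.ne'] at this
    exact this
end

section
/- Let A be an n×m matrix and B a k×m matrix, both with nonnegative integer entries and both of rank r over the rationals. Suppose that (i) A and B have the same row space over ℚ, (ii) for every x ∈ ℚᵐ, A·x has all integer entries if and only if B·x has all integer entries, and (iii) for every x ∈ ℝᵐ, A·x has all nonnegative entries if and only if B·x has all nonnegative entries. Then rank_{ℤ₊}(A) = r if and only if rank_{ℤ₊}(B) = r. -/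
/-- The nonnegative integer rank of a matrix with nonnegative integer entries. -/
noncomputable def nnirank {n m : ℕ} (A : Matrix (Fin n) (Fin m) ℕ) : ℕ :=
  sInf {k | ∃ B : Matrix (Fin n) (Fin k) ℕ, ∃ C : Matrix (Fin k) (Fin m) ℕ, A = B * C}

theorem aux_iff {n m r : ℕ} (A : Matrix (Fin n) (Fin m) ℕ)
    (hrA : (A.map (fun x => (x : ℚ))).rank = r) :
    nnirank A = r ↔ ∃ B : Matrix (Fin n) (Fin r) ℕ, ∃ C : Matrix (Fin r) (Fin m) ℕ, A = B * C := by
  have hne : {k | ∃ B : Matrix (Fin n) (Fin k) ℕ, ∃ C : Matrix (Fin k) (Fin m) ℕ,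
      A = B * C}.Nonempty := ⟨m, A, 1, by simp⟩
  constructor
  · intro h
    have := Nat.sInf_mem hne
    unfold nnirank at h
    rw [h] at this
    exact this
  · intro h
    apply le_antisymm
    · exact Nat.sInf_le h
    · obtain ⟨U, V, hUV⟩ := Nat.sInf_mem hne
      change r ≤ sInf _
      have e : A.map (fun x => (x : ℚ)) =
          U.map (fun x => (x : ℚ)) * V.map (fun x => (x : ℚ)) := by
        ext i j
        have := congrFun (congrFun hUV i) j
        simp [Matrix.mul_apply, this]
      rw [← hrA, e]
      refine (Matrix.rank_mul_le_left _ _).trans ?_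
      exact Matrix.rank_le_width _

theorem aux_dir {n k m r : ℕ} (A : Matrix (Fin n) (Fin m) ℕ) (B : Matrix (Fin k) (Fin m) ℕ)
    (hrA : (A.map (fun x => (x : ℚ))).rank = r)
    (hrow : Submodule.span ℚ (Set.range (A.map (fun x => (x : ℚ)))) =
      Submodule.span ℚ (Set.range (B.map (fun x => (x : ℚ)))))
    (hint : ∀ x : Fin m → ℚ,
      (∀ i, ∃ z : ℤ, (A.map (fun a => (a : ℚ))).mulVec x i = z) ↔
      (∀ i, ∃ z : ℤ, (B.map (fun a => (a : ℚ))).mulVec x i = z))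
    (hpos : ∀ x : Fin m → ℝ,
      (∀ i, 0 ≤ (A.map (fun a => (a : ℝ))).mulVec x i) ↔
      (∀ i, 0 ≤ (B.map (fun a => (a : ℝ))).mulVec x i))
    (h : ∃ U : Matrix (Fin n) (Fin r) ℕ, ∃ V : Matrix (Fin r) (Fin m) ℕ, A = U * V) :
    ∃ U : Matrix (Fin k) (Fin r) ℕ, ∃ V : Matrix (Fin r) (Fin m) ℕ, B = U * V := by
  obtain ⟨U, V, hUV⟩ := h
  set A' := A.map (fun x => (x : ℚ)) with hA'
  set B' := B.map (fun x => (x : ℚ)) with hB'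
  set U' := U.map (fun x => (x : ℚ)) with hU'
  set V' := V.map (fun x => (x : ℚ)) with hV'
  have e : A' = U' * V' := by
    ext i j
    have := congrFun (congrFun hUV i) j
    simp [hA', hU', hV', Matrix.mul_apply, this]
  have hVr : V'.rank = r := by
    apply le_antisymm
    · exact Matrix.rank_le_height _
    · have h0 : A'.rank ≤ V'.rank := by rw [e]; exact Matrix.rank_mul_le_right _ _
      exact hrA.symm.le.trans h0
  have hsurj : Function.Surjective V'.mulVec := by
    have : LinearMap.range V'.mulVecLin = ⊤ := by
      apply Submodule.eq_top_of_finrank_eq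
      rw [← Matrix.rank, hVr]; simp
    exact LinearMap.range_eq_top.mp this
  obtain ⟨X, hX⟩ := Matrix.mulVec_surjective_iff_exists_right_inverse.mp hsurj
  have hAX : A' * X = U' := by rw [e, Matrix.mul_assoc, hX, Matrix.mul_one]
  have hD : ∀ i, ∃ c : Fin n → ℚ, ∑ l, c l • A'.row l = B'.row i := by
    intro i
    refine (Submodule.mem_span_range_iff_exists_fun ℚ (v := A'.row)).1 ?_
    have h0 : B' i ∈ Submodule.span ℚ (Set.range A') := by
      rw [hrow]
      exact Submodule.subset_span ⟨i, rfl⟩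
    exact h0
  choose D hD using hD
  have hBD : B' = (Matrix.of D) * A' := by
    ext i j
    have h0 := congrFun (hD i) j
    simp only [Finset.sum_apply, Pi.smul_apply, smul_eq_mul, Matrix.row_apply] at h0
    rw [← h0]
    simp [Matrix.mul_apply]
  have hBX : B' = (B' * X) * V' := by
    rw [hBD, e]
    simp only [Matrix.mul_assoc]
    rw [← Matrix.mul_assoc V' X V', hX, Matrix.one_mul]
  have hW : ∀ i j, ∃ w : ℕ, (B' * X) i j = w := by
    intro i j
    have h1 := (hint (fun l => X l j)).1 (by
      intro i
      refine ⟨U i j, ?_⟩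
      have : (A' * X) i j = U' i j := by rw [hAX]
      rw [Matrix.mul_apply] at this
      simp only [Matrix.mulVec, dotProduct]
      rw [this]; simp [hU']) i
    have h2 := (hpos (fun l => (X l j : ℝ))).1 (by
      intro i
      have : (A' * X) i j = U' i j := by rw [hAX]
      rw [Matrix.mul_apply] at this
      have h3 := congrArg (fun q : ℚ => (q : ℝ)) this
      simp only [hA', hU', Matrix.map_apply] at h3
      push_cast at h3
      simp only [Matrix.mulVec, dotProduct, Matrix.map_apply]
      rw [h3]; positivity) i
    obtain ⟨z, hz⟩ := h1
    have hz' : (B' * X) i j = z := hz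
    have h4 : (0:ℝ) ≤ (((B' * X) i j : ℚ) : ℝ) := by
      simpa [Matrix.mul_apply, Matrix.mulVec, dotProduct, hB'] using h2
    rw [hz'] at h4
    have h5 : 0 ≤ z := by exact_mod_cast h4
    obtain ⟨w, rfl⟩ := Int.eq_ofNat_of_zero_le h5
    exact ⟨w, by rw [hz']; simp⟩
  choose W hW using hW
  refine ⟨Matrix.of W, V, ?_⟩
  ext i j
  have h6 : B' i j = ((B' * X) * V') i j := by rw [← hBX]
  rw [Matrix.mul_apply] at h6
  simp only [hW] at h6
  simp only [hB', hV', Matrix.map_apply] at h6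
  rw [Matrix.mul_apply]
  simp only [Matrix.of_apply]
  exact_mod_cast h6

theorem stmt4 {n k m r : ℕ} (A : Matrix (Fin n) (Fin m) ℕ) (B : Matrix (Fin k) (Fin m) ℕ)
    (hrA : (A.map (fun x => (x : ℚ))).rank = r)
    (hrB : (B.map (fun x => (x : ℚ))).rank = r)
    -- (i) same row space over ℚ
    (hrow : Submodule.span ℚ (Set.range (A.map (fun x => (x : ℚ)))) =
      Submodule.span ℚ (Set.range (B.map (fun x => (x : ℚ)))))
    -- (ii) A·x integral iff B·x integral
    (hint : ∀ x : Fin m → ℚ,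
      (∀ i, ∃ z : ℤ, (A.map (fun a => (a : ℚ))).mulVec x i = z) ↔
      (∀ i, ∃ z : ℤ, (B.map (fun a => (a : ℚ))).mulVec x i = z))
    -- (iii) A·x nonnegative iff B·x nonnegative
    (hpos : ∀ x : Fin m → ℝ,
      (∀ i, 0 ≤ (A.map (fun a => (a : ℝ))).mulVec x i) ↔
      (∀ i, 0 ≤ (B.map (fun a => (a : ℝ))).mulVec x i)) :
    nnirank A = r ↔ nnirank B = r := by
  rw [aux_iff A hrA, aux_iff B hrB]
  exact ⟨aux_dir A B hrA hrow hint hpos,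
    aux_dir B A hrB hrow.symm (fun x => (hint x).symm) (fun x => (hpos x).symm)⟩
end

section
/- The 3×3 matrix A with rows (2, 0, 3), (1, 1, 4), (1, 3, 9) has rank 2 over the rationals and nonnegative integer rank rank_{ℤ₊}(A) = 3. -/
theorem aux_key (a b c d e f p q r s t u : ℕ) (h1 : a*p+b*s=2) (ha : a = 0) (ht : t = 0)
    (h3 : a*r+b*u=3) (h4 : c*p+d*s=1) (h5 : c*q+d*t=1)
    (h7 : e*p+f*s=1) (h8 : e*q+f*t=3) : False := by
  subst ha ht
  simp only [zero_mul, zero_add, mul_zero, add_zero] at *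
  have hb : b ∣ 1 := by
    have h2 : b ∣ 2 := ⟨s, h1.symm⟩
    have h3' : b ∣ 3 := ⟨u, h3.symm⟩
    exact (Nat.dvd_add_right h2).1 h3'
  have hb1 : b = 1 := Nat.dvd_one.1 hb
  subst hb1
  have hs : s = 2 := by omega
  subst hs
  have hq : q = 1 := Nat.eq_one_of_mul_eq_one_left h5
  have hc : c = 1 := Nat.eq_one_of_mul_eq_one_right h5
  subst hq
  have he : e = 3 := by omega
  subst he
  omega

theorem stmt7 :
    ((!![2, 0, 3; 1, 1, 4; 1, 3, 9] : Matrix (Fin 3) (Fin 3) ℕ).map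
        (fun x => (x : ℚ))).rank = 2 ∧
    nnirank (!![2, 0, 3; 1, 1, 4; 1, 3, 9] : Matrix (Fin 3) (Fin 3) ℕ) = 3 := by
  constructor
  · apply le_antisymm
    · have h : ((!![2, 0, 3; 1, 1, 4; 1, 3, 9] : Matrix (Fin 3) (Fin 3) ℕ).map
        (fun x => (x : ℚ))) = (!![2, 0; 1, 1; 1, 3] : Matrix (Fin 3) (Fin 2) ℚ) *
          (!![1, 0, 3/2; 0, 1, 5/2] : Matrix (Fin 2) (Fin 3) ℚ) := by
        ext i j
        fin_cases i <;> fin_cases j <;> simp [Matrix.mul_apply, Fin.sum_univ_two] <;> norm_num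
      rw [h]
      refine (Matrix.rank_mul_le_left _ _).trans ?_
      simpa using Matrix.rank_le_width (!![2, 0; 1, 1; 1, 3] : Matrix (Fin 3) (Fin 2) ℚ)
    · have h : (!![1/2, 0, 0; -1/2, 1, 0] : Matrix (Fin 2) (Fin 3) ℚ) *
        ((!![2, 0, 3; 1, 1, 4; 1, 3, 9] : Matrix (Fin 3) (Fin 3) ℕ).map
        (fun x => (x : ℚ))) * (!![1, 0; 0, 1; 0, 0] : Matrix (Fin 3) (Fin 2) ℚ) = 1 := by
        ext i j
        fin_cases i <;> fin_cases j <;>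
          simp [Matrix.mul_apply, Matrix.vecMul, dotProduct, Fin.sum_univ_three] <;> norm_num
      have h2 := congrArg Matrix.rank h
      rw [Matrix.rank_one, Fintype.card_fin] at h2
      exact h2.symm.le.trans <| (Matrix.rank_mul_le_left _ _).trans (Matrix.rank_mul_le_right _ _)
  · unfold nnirank
    apply le_antisymm
    · exact Nat.sInf_le ⟨_, 1, (Matrix.mul_one _).symm⟩
    · refine le_csInf ⟨3, _, 1, (Matrix.mul_one _).symm⟩ ?_
      rintro k ⟨B, C, h⟩
      by_contra hk
      have H := fun i j => congrFun (congrFun h i) j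
      have h1 := H 0 0
      have h2 := H 0 1
      have h3 := H 0 2
      have h4 := H 1 0
      have h5 := H 1 1
      have h7 := H 2 0
      have h8 := H 2 1
      clear H h
      have hk' : k = 0 ∨ k = 1 ∨ k = 2 := by omega
      rcases hk' with rfl | rfl | rfl
      · simp [Matrix.mul_apply] at h1
      · simp [Matrix.mul_apply] at h1 h2 h5
        rcases h2 with h2 | h2 <;> simp [h2] at h1 h5
      · simp [Matrix.mul_apply, Fin.sum_univ_two, -mul_eq_zero, -Nat.add_eq_zero_iff]
          at h1 h2 h3 h4 h5 h7 h8
        have h2a : B 0 0 * C 0 1 = 0 := by omega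
        have h2b : B 0 1 * C 1 1 = 0 := by omega
        rcases Nat.mul_eq_zero.1 h2a with ha | ha <;> rcases Nat.mul_eq_zero.1 h2b with hb | hb
        · simp [ha, hb] at h1
        · exact aux_key _ _ _ _ _ _ _ _ _ _ _ _ h1.symm ha hb h3.symm h4.symm h5.symm
            h7.symm h8.symm
        · rw [add_comm] at h1 h3 h4 h5 h7 h8
          exact aux_key _ _ _ _ _ _ _ _ _ _ _ _ h1.symm hb ha h3.symm h4.symm h5.symm
            h7.symm h8.symm
        · simp [ha, hb] at h5
end

section
/- For every integer t ≥ 1, the 3×3 matrix B_t with rows (t+1, t, t−1), (t, t, t), (t−1, t, t+1) has rank 2 over the rationals and nonnegative integer rank rank_{ℤ₊}(B_t) = 3. -/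
theorem aux_pos (t a b c d p q r s : ℤ) (ht : 1 ≤ t)
    (h1 : a * c + b * d = t) (h2 : p * r + q * s = 1) (h3 : a * r + b * s = 0)
    (h4 : p * c + q * d = 0) (hc : 0 ≤ c) (hd : 0 ≤ d) (ha : 0 ≤ a) (hb : 0 ≤ b)
    (hp : -a ≤ p) (hq : q ≤ b) (hr : -c ≤ r) (hs : s ≤ d)
    (hD : 0 < a * q - p * b) : False := by
  have e1 : s * (a * q - p * b) = a := by linear_combination a * h2 - p * h3
  have e2 : r * (a * q - p * b) = -b := by linear_combination q * h3 - b * h2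
  have e3 : c * (a * q - p * b) = q * t := by linear_combination q * h1 - b * h4
  have e4 : d * (a * q - p * b) = -p * t := by linear_combination a * h4 - p * h1
  have q0 : 0 ≤ q := by
    by_contra h
    nlinarith [mul_nonneg hc hD.le]
  have p0 : p ≤ 0 := by
    by_contra h
    nlinarith [mul_nonneg hd hD.le]
  have s0 : 0 ≤ s := by
    by_contra h
    nlinarith
  have r0 : r ≤ 0 := by
    by_contra h
    nlinarith
  have x1 : 0 ≤ p * r := mul_nonneg_of_nonpos_of_nonpos p0 r0
  have x2 : 0 ≤ q * s := mul_nonneg q0 s0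
  have : (p * r = 1) ∨ (q * s = 1) := by omega
  rcases this with h | h
  · have hpr : p = -1 ∧ r = -1 := by
      rcases Int.eq_one_or_neg_one_of_mul_eq_one' h with h | h <;> omega
    obtain ⟨rfl, rfl⟩ := hpr
    have : a * q = 0 := by linarith
    rcases mul_eq_zero.1 this with h | h
    · omega
    · subst h
      have : c * (a * 0 - -1 * b) = 0 := by linarith
      rcases mul_eq_zero.1 this with h | h <;> omega
  · have hpr : q = 1 ∧ s = 1 := by
      rcases Int.eq_one_or_neg_one_of_mul_eq_one' h with h | h <;> omega
    obtain ⟨rfl, rfl⟩ := hpr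
    have : p * b = 0 := by linarith
    rcases mul_eq_zero.1 this with h | h
    · subst h
      have : d * (a * 1 - 0 * b) = 0 := by linarith
      rcases mul_eq_zero.1 this with h | h <;> omega
    · omega

theorem aux_main (t x1 x2 x3 y1 y2 y3 u1 u2 u3 v1 v2 v3 : ℤ) (ht : 1 ≤ t)
    (hx1 : 0 ≤ x1) (hx2 : 0 ≤ x2) (hx3 : 0 ≤ x3)
    (hy1 : 0 ≤ y1) (hy2 : 0 ≤ y2) (hy3 : 0 ≤ y3)
    (hu1 : 0 ≤ u1) (hu2 : 0 ≤ u2) (hu3 : 0 ≤ u3)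
    (hv1 : 0 ≤ v1) (hv2 : 0 ≤ v2) (hv3 : 0 ≤ v3)
    (e11 : x1 * u1 + y1 * v1 = t + 1) (e12 : x1 * u2 + y1 * v2 = t)
    (e13 : x1 * u3 + y1 * v3 = t - 1)
    (e21 : x2 * u1 + y2 * v1 = t) (e22 : x2 * u2 + y2 * v2 = t)
    (e23 : x2 * u3 + y2 * v3 = t)
    (e31 : x3 * u1 + y3 * v1 = t - 1) (e32 : x3 * u2 + y3 * v2 = t)
    (e33 : x3 * u3 + y3 * v3 = t + 1) : False := by
  have hdet : (x1 * y2 - x2 * y1) * (u1 * v2 - u2 * v1) = t := by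
    have : (x1 * y2 - x2 * y1) * (u1 * v2 - u2 * v1) =
      (x1 * u1 + y1 * v1) * (x2 * u2 + y2 * v2) - (x1 * u2 + y1 * v2) * (x2 * u1 + y2 * v1) := by
      ring
    rw [this, e11, e12, e21, e22]; ring
  have hX : x1 * y2 - x2 * y1 ≠ 0 := by
    intro h; rw [h] at hdet; omega
  have hU : u1 * v2 - u2 * v1 ≠ 0 := by
    intro h; rw [h] at hdet; omega
  have ax : x1 + x3 - 2 * x2 = 0 := by
    refine (mul_eq_zero.1 (?_ : (x1 + x3 - 2 * x2) * (u1 * v2 - u2 * v1) = 0)).resolve_right hU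
    linear_combination v2 * (e11 + e31 - 2 * e21) - v1 * (e12 + e32 - 2 * e22)
  have ay : y1 + y3 - 2 * y2 = 0 := by
    refine (mul_eq_zero.1 (?_ : (y1 + y3 - 2 * y2) * (u1 * v2 - u2 * v1) = 0)).resolve_right hU
    linear_combination -u2 * (e11 + e31 - 2 * e21) + u1 * (e12 + e32 - 2 * e22)
  have au : u1 + u3 - 2 * u2 = 0 := by
    refine (mul_eq_zero.1 (?_ : (u1 + u3 - 2 * u2) * (x1 * y2 - x2 * y1) = 0)).resolve_right hX
    linear_combination y2 * (e11 + e13 - 2 * e12) - y1 * (e21 + e23 - 2 * e22)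
  have av : v1 + v3 - 2 * v2 = 0 := by
    refine (mul_eq_zero.1 (?_ : (v1 + v3 - 2 * v2) * (x1 * y2 - x2 * y1) = 0)).resolve_right hX
    linear_combination -x2 * (e11 + e13 - 2 * e12) + x1 * (e21 + e23 - 2 * e22)
  have k2 : (x3 - x2) * (u3 - u2) + (y3 - y2) * (v3 - v2) = 1 := by
    linear_combination e33 - e32 - e23 + e22
  have k3 : x2 * (u3 - u2) + y2 * (v3 - v2) = 0 := by linear_combination e23 - e22
  have k4 : (x3 - x2) * u2 + (y3 - y2) * v2 = 0 := by linear_combination e32 - e22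
  have hD : x2 * (y3 - y2) - (x3 - x2) * y2 ≠ 0 := by
    intro h
    apply hX
    linear_combination h + y2 * ax - x2 * ay
  rcases lt_or_gt_of_ne hD with h | h
  · exact aux_pos t y2 x2 v2 u2 (y3 - y2) (x3 - x2) (v3 - v2) (u3 - u2) ht (by linarith)
      (by linarith) (by linarith) (by linarith) hv2 hu2 hy2 hx2 (by omega) (by omega) (by omega)
      (by omega) (by linarith)
  · exact aux_pos t x2 y2 u2 v2 (x3 - x2) (y3 - y2) (u3 - u2) (v3 - v2) ht e22
      k2 k3 k4 hu2 hv2 hx2 hy2 (by omega) (by omega) (by omega)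
      (by omega) h

theorem stmt8 (t : ℕ) (ht : 1 ≤ t) :
    ((!![t + 1, t, t - 1; t, t, t; t - 1, t, t + 1] : Matrix (Fin 3) (Fin 3) ℕ).map
        (fun x => (x : ℚ))).rank = 2 ∧
    nnirank (!![t + 1, t, t - 1; t, t, t; t - 1, t, t + 1] : Matrix (Fin 3) (Fin 3) ℕ) = 3 := by
  constructor
  · have hA : ((!![t + 1, t, t - 1; t, t, t; t - 1, t, t + 1] : Matrix (Fin 3) (Fin 3) ℕ).map
        (fun x => (x : ℚ))) = !![(t:ℚ) + 1, t, t - 1; t, t, t; t - 1, t, t + 1] := by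
      ext i j
      fin_cases i <;> fin_cases j <;> simp [Nat.cast_sub ht]
    have t0 : (t : ℚ) ≠ 0 := by positivity
    rw [hA]
    apply le_antisymm
    · have : (!![(t:ℚ) + 1, t, t - 1; t, t, t; t - 1, t, t + 1] : Matrix (Fin 3) (Fin 3) ℚ) =
        (!![1, -1; 1, 0; 1, 1] : Matrix (Fin 3) (Fin 2) ℚ) *
        (!![(t:ℚ), t, t; -1, 0, 1] : Matrix (Fin 2) (Fin 3) ℚ) := by
        ext i j
        fin_cases i <;> fin_cases j <;> simp [Matrix.mul_apply, Fin.sum_univ_two] <;> ring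
      rw [this]
      refine (Matrix.rank_mul_le_left _ _).trans ?_
      exact (Matrix.rank_le_width _)
    · have : (!![0, 1 / (t:ℚ), 0; 0, -1, 1] : Matrix (Fin 2) (Fin 3) ℚ) *
        (!![(t:ℚ) + 1, t, t - 1; t, t, t; t - 1, t, t + 1] : Matrix (Fin 3) (Fin 3) ℚ) *
        (!![0, 0; 1, -1; 0, 1] : Matrix (Fin 3) (Fin 2) ℚ) = 1 := by
        ext i j
        fin_cases i <;> fin_cases j <;>
          simp [Matrix.mul_apply, Fin.sum_univ_three, t0]
      have h2 : (1 : Matrix (Fin 2) (Fin 2) ℚ).rank = 2 := by simp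
      rw [← this] at h2
      refine h2.symm.le.trans ?_
      exact (Matrix.rank_mul_le_left _ _).trans (Matrix.rank_mul_le_right _ _)
  · unfold nnirank
    apply le_antisymm
    · exact Nat.sInf_le ⟨_, 1, (Matrix.mul_one _).symm⟩
    · refine le_csInf (Set.nonempty_of_mem (x := 3) ⟨_, 1, (Matrix.mul_one _).symm⟩) ?_
      rintro k ⟨B, C, h⟩
      by_contra hk
      have hZ : ∀ i j, ((!![t + 1, t, t - 1; t, t, t; t - 1, t, t + 1] :
          Matrix (Fin 3) (Fin 3) ℕ) i j : ℤ) = ∑ l, (B i l : ℤ) * (C l j : ℤ) := by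
        intro i j
        rw [h, Matrix.mul_apply]
        push_cast
        rfl
      obtain ⟨x, y, u, v, hx⟩ : ∃ x y u v : Fin 3 → ℕ, ∀ i j,
          ((!![t + 1, t, t - 1; t, t, t; t - 1, t, t + 1] :
          Matrix (Fin 3) (Fin 3) ℕ) i j : ℤ) = x i * u j + y i * v j := by
        have : k = 0 ∨ k = 1 ∨ k = 2 := by omega
        rcases this with rfl | rfl | rfl
        · exact ⟨0, 0, 0, 0, fun i j => by rw [hZ]; simp⟩
        · exact ⟨fun i => B i 0, 0, fun j => C 0 j, 0, fun i j => by rw [hZ]; simp⟩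
        · exact ⟨fun i => B i 0, fun i => B i 1, fun j => C 0 j, fun j => C 1 j,
            fun i j => by rw [hZ, Fin.sum_univ_two]⟩
      have e11 := hx 0 0
      have e12 := hx 0 1
      have e13 := hx 0 2
      have e21 := hx 1 0
      have e22 := hx 1 1
      have e23 := hx 1 2
      have e31 := hx 2 0
      have e32 := hx 2 1
      have e33 := hx 2 2
      simp [Nat.cast_sub ht] at e11 e12 e13 e21 e22 e23 e31 e32 e33
      exact aux_main t (x 0) (x 1) (x 2) (y 0) (y 1) (y 2) (u 0) (u 1) (u 2) (v 0) (v 1) (v 2)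
        (by exact_mod_cast ht) (by positivity) (by positivity) (by positivity) (by positivity)
        (by positivity) (by positivity) (by positivity) (by positivity) (by positivity)
        (by positivity) (by positivity) (by positivity)
        e11.symm e12.symm e13.symm e21.symm e22.symm e23.symm e31.symm e32.symm e33.symm
end

section
/- For every integer t ≥ 1, there do not exist vectors a, b ∈ ℤ², each lying in the cone {(x, y) ∈ ℝ² : y ≥ x and y ≥ −x} (the cone generated by (−1,1) and (1,1)), such that each of the three points (−1, t), (0, t), and (1, t) is a nonnegative integer combination of a and b. -/
/-- The cone `{(x, y) ∈ ℝ² : y ≥ x and y ≥ -x}`, i.e. the cone generated by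
`(-1, 1)` and `(1, 1)`. -/
def K : Set (Fin 2 → ℝ) := {p | p 0 ≤ p 1 ∧ -p 0 ≤ p 1}

/-- Core case: the step `(p, -q)` with `p, q > 0`. -/
lemma core_case (x y p q M N : ℤ) (hp : 0 < p) (hq : 0 < q) (hM : p ≤ M) (hN : q ≤ N)
    (h1 : p * x - q * y = 1) (h0 : M * x + N * y = 0) : False := by
  rcases lt_trichotomy x 0 with hx | hx | hx
  · have hy : 0 < y := by
      by_contra hy
      nlinarith [mul_pos (lt_of_lt_of_le hp hM) (neg_pos.2 hx)]
    nlinarith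
  · subst hx
    have : N * y = 0 := by linarith
    rcases mul_eq_zero.1 this with h | h
    · omega
    · subst h; omega
  · have hy : y < 0 := by
      by_contra hy
      nlinarith [mul_pos (lt_of_lt_of_le hp hM) hx]
    nlinarith

theorem stmt9 (t : ℤ) (ht : 1 ≤ t) :
    ¬ ∃ a b : Fin 2 → ℤ,
      (fun i => (a i : ℝ)) ∈ K ∧ (fun i => (b i : ℝ)) ∈ K ∧
      ∀ c ∈ ({![-1, t], ![0, t], ![1, t]} : Set (Fin 2 → ℤ)),
        ∃ k ℓ : ℕ, c = (k : ℤ) • a + (ℓ : ℤ) • b := by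
  rintro ⟨a, b, ⟨ha1, ha2⟩, ⟨hb1, hb2⟩, h⟩
  obtain ⟨k, l, h1⟩ := h ![-1, t] (by simp)
  obtain ⟨m, n, h2⟩ := h ![0, t] (by simp)
  obtain ⟨r, s, h3⟩ := h ![1, t] (by simp)
  have e1 := congrFun h1 0
  have f1 := congrFun h1 1
  have e2 := congrFun h2 0
  have f2 := congrFun h2 1
  have e3 := congrFun h3 0
  have f3 := congrFun h3 1
  simp at e1 f1 e2 f2 e3 f3
  clear h h1 h2 h3
  dsimp only at ha1 ha2 hb1 hb2
  norm_cast at ha1 ha2 hb1 hb2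
  generalize a 0 = x at *
  generalize a 1 = u at *
  generalize b 0 = y at *
  generalize b 1 = v at *
  have k0 : (0:ℤ) ≤ k := by positivity
  have l0 : (0:ℤ) ≤ l := by positivity
  have m0 : (0:ℤ) ≤ m := by positivity
  have n0 : (0:ℤ) ≤ n := by positivity
  have r0 : (0:ℤ) ≤ r := by positivity
  have s0 : (0:ℤ) ≤ s := by positivity
  generalize (k:ℤ) = k at *
  generalize (l:ℤ) = l at *
  generalize (m:ℤ) = m at *
  generalize (n:ℤ) = n at *
  generalize (r:ℤ) = r at *
  generalize (s:ℤ) = s at *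
  have A : (m - k) * x + (n - l) * y = 1 := by linarith
  have B : (m - k) * u + (n - l) * v = 0 := by linarith
  have A' : (r - m) * x + (s - n) * y = 1 := by linarith
  have B' : (r - m) * u + (s - n) * v = 0 := by linarith
  have P : (m - k) * (x * v - u * y) = v := by linear_combination v * A - y * B
  have Q : (n - l) * (x * v - u * y) = -u := by linear_combination x * B - u * A
  have P' : (r - m) * (x * v - u * y) = v := by linear_combination v * A' - y * B'
  have Q' : (s - n) * (x * v - u * y) = -u := by linear_combination x * B' - u * A'
  have hu : 0 ≤ u := by omega
  have hv : 0 ≤ v := by omega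
  have D : x * v - u * y ≠ 0 := by
    intro D
    rw [D] at P Q
    have hx : x = 0 := by omega
    have hy : y = 0 := by omega
    rw [hx, hy] at A
    simp at A
  have hpp : m - k = r - m := mul_right_cancel₀ D (P.trans P'.symm)
  have hqq : n - l = s - n := mul_right_cancel₀ D (Q.trans Q'.symm)
  have hu' : 0 < u := by
    rcases hu.lt_or_eq with h | h
    · exact h
    · subst h
      have : x = 0 := by omega
      subst this
      simp at D
  have hv' : 0 < v := by
    rcases hv.lt_or_eq with h | h
    · exact h
    · subst h
      have : y = 0 := by omega
      subst this
      simp at D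
  rcases lt_or_gt_of_ne D with hD | hD
  · have hp : m - k < 0 := by
      by_contra hc
      nlinarith
    have hq : 0 < n - l := by
      by_contra hc
      nlinarith
    exact core_case y x (n - l) (k - m) n m hq (by omega) (by omega) (by omega)
      (by linarith) (by linarith)
  · have hp : 0 < m - k := by
      by_contra hc
      nlinarith
    have hq : n - l < 0 := by
      by_contra hc
      nlinarith
    exact core_case x y (m - k) (l - n) m n hp (by omega) (by omega) (by omega)
      (by linarith) (by linarith)
end

section
/- Let M be the 3×4 matrix with rows (0, 6, 10, 15), (1, 3, 5, 8), (5, 9, 15, 25). Then rank_{ℤ₊}(M) = 3, yet every one of the four 3×3 submatrices obtained by deleting a single column of M has nonnegative integer rank equal to 2. In particular, a rank-2 nonnegative integer matrix can fail to have nonnegative integer rank 2 even though all of its 3×3 submatrices do. -/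
theorem nnirank_eq_of {n m r : ℕ} (A : Matrix (Fin n) (Fin m) ℕ)
    (h : ∃ B : Matrix (Fin n) (Fin r) ℕ, ∃ C : Matrix (Fin r) (Fin m) ℕ, A = B * C)
    (hl : ∀ k < r, ¬ ∃ B : Matrix (Fin n) (Fin k) ℕ, ∃ C : Matrix (Fin k) (Fin m) ℕ, A = B * C) :
    nnirank A = r := by
  unfold nnirank
  apply le_antisymm
  · exact Nat.sInf_le h
  · by_contra hlt
    push Not at hlt
    exact hl _ hlt (Nat.sInf_mem (s := {k | ∃ B : Matrix (Fin n) (Fin k) ℕ,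
      ∃ C : Matrix (Fin k) (Fin m) ℕ, A = B * C}) ⟨r, h⟩)

theorem no_small {n m : ℕ} (A : Matrix (Fin n) (Fin m) ℕ) (i i' : Fin n) (j j' : Fin m)
    (hA : A i j * A i' j' ≠ A i j' * A i' j) :
    ∀ k < 2, ¬ ∃ B : Matrix (Fin n) (Fin k) ℕ, ∃ C : Matrix (Fin k) (Fin m) ℕ, A = B * C := by
  rintro k hk ⟨B, C, rfl⟩
  apply hA
  interval_cases k
  · simp [Matrix.mul_apply]
  · simp only [Matrix.mul_apply, Fin.sum_univ_one]
    ring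

/-- The heart of the lower bound, with the factor having entry 1 in row two put first. -/
theorem core {b0 b1 b2 d0 d1 d2 x0 x1 x2 x3 y0 y1 y2 y3 : ℕ}
    (h00 : b0 * x0 + d0 * y0 = 0) (h01 : b0 * x1 + d0 * y1 = 6)
    (h02 : b0 * x2 + d0 * y2 = 10) (h03 : b0 * x3 + d0 * y3 = 15)
    (h11 : b1 * x1 + d1 * y1 = 3)
    (h13 : b1 * x3 + d1 * y3 = 8)
    (h20 : b2 * x0 + d2 * y0 = 5) (h21 : b2 * x1 + d2 * y1 = 9)
    (hx : b1 * x0 = 1) (hy : d1 * y0 = 0) : False := by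
  obtain ⟨rfl, rfl⟩ := mul_eq_one.mp hx
  have hb : b0 = 0 := by omega
  subst hb
  have hdy : d0 * y0 = 0 := by omega
  have hd0 : d0 ≠ 0 := by rintro rfl; omega
  have hy0 : y0 = 0 := by
    rcases Nat.mul_eq_zero.mp hdy with h | h
    · exact absurd h hd0
    · exact h
  subst hy0
  have e1 : d0 ∣ 6 := ⟨y1, by omega⟩
  have e2 : d0 ∣ 10 := ⟨y2, by omega⟩
  have e3 : d0 ∣ 15 := ⟨y3, by omega⟩
  have e : d0 ∣ 1 := by
    have := Nat.dvd_gcd (Nat.dvd_gcd e1 e2) e3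
    simpa using this
  have hd : d0 = 1 := Nat.dvd_one.mp e
  subst hd
  have hy1 : y1 = 6 := by omega
  subst hy1
  have : d1 = 0 := by omega
  subst this
  have : b2 = 5 := by omega
  subst this
  omega

theorem stmt10 :
    nnirank (!![0, 6, 10, 15; 1, 3, 5, 8; 5, 9, 15, 25] : Matrix (Fin 3) (Fin 4) ℕ) = 3 ∧
    ∀ j : Fin 4,
      nnirank ((!![0, 6, 10, 15; 1, 3, 5, 8; 5, 9, 15, 25] : Matrix (Fin 3) (Fin 4) ℕ).submatrix
        id j.succAbove) = 2 := by
  constructor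
  · apply nnirank_eq_of
    · exact ⟨1, _, (Matrix.one_mul _).symm⟩
    · intro k hk
      rcases Nat.lt_or_ge k 2 with h | h
      · exact no_small _ 0 1 0 1 (by decide) k h
      · obtain rfl : k = 2 := by omega
        rintro ⟨B, C, h⟩
        have key : ∀ i j, B i 0 * C 0 j + B i 1 * C 1 j =
            (!![0, 6, 10, 15; 1, 3, 5, 8; 5, 9, 15, 25] : Matrix (Fin 3) (Fin 4) ℕ) i j := by
          intro i j
          rw [h, Matrix.mul_apply, Fin.sum_univ_two]
        have h00 := key 0 0
        have h01 := key 0 1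
        have h02 := key 0 2
        have h03 := key 0 3
        have h10 := key 1 0
        have h11 := key 1 1
        have h13 := key 1 3
        have h20 := key 2 0
        have h21 := key 2 1
        simp only [Matrix.of_apply, Matrix.cons_val] at h00 h01 h02 h03 h10 h11 h13 h20 h21
        rcases Nat.eq_zero_or_pos (B 1 1 * C 1 0) with h' | h'
        · exact core h00 h01 h02 h03 h11 h13 h20 h21 (by omega) h'
        · rw [add_comm] at h00 h01 h02 h03 h11 h13 h20 h21
          exact core h00 h01 h02 h03 h11 h13 h20 h21 (by omega) (by omega)
  · intro j
    fin_cases j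
    · exact nnirank_eq_of _ ⟨!![2, 1; 1, 1; 3, 4], !![3, 5, 7; 0, 0, 1], by decide⟩
        (no_small _ 0 1 0 2 (by decide))
    · exact nnirank_eq_of _ ⟨!![0, 5; 1, 1; 5, 0], !![1, 3, 5; 0, 2, 3], by decide⟩
        (no_small _ 0 1 0 2 (by decide))
    · exact nnirank_eq_of _ ⟨!![0, 3; 1, 1; 5, 2], !![1, 1, 3; 0, 2, 5], by decide⟩
        (no_small _ 0 1 0 2 (by decide))
    · exact nnirank_eq_of _ ⟨!![0, 2; 1, 1; 5, 3], !![1, 0, 0; 0, 3, 5], by decide⟩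
        (no_small _ 0 1 0 1 (by decide))
end

section
/- Let w₁, u, v, w₂ ∈ ℝ² be nonzero vectors with det(w₁, u) ≥ 0, det(u, v) > 0, det(v, w₂) ≥ 0, and det(w₁, w₂) > 0, where det((x₁,y₁),(x₂,y₂)) = x₁y₂ − x₂y₁, and suppose u, v ∈ cone(w₁, w₂). If a, b ∈ cone(w₁, w₂) are such that both u and v lie in cone(a, b), then, after possibly swapping a and b, a ∈ cone(w₁, u) and b ∈ cone(v, w₂). -/
/-- The 2×2 determinant of two vectors in `ℝ²`. -/
def det2 (p q : Fin 2 → ℝ) : ℝ := p 0 * q 1 - q 0 * p 1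

theorem cone_swap (u v : Fin 2 → ℝ) : cone u v = cone v u := by
  ext x
  constructor
  · rintro ⟨s, t, hs, ht, rfl⟩
    exact ⟨t, s, ht, hs, add_comm _ _⟩
  · rintro ⟨s, t, hs, ht, rfl⟩
    exact ⟨t, s, ht, hs, add_comm _ _⟩

theorem cone_coef (w₁ w₂ : Fin 2 → ℝ) (x₁ x₂ u₁ u₂ : ℝ) (hx₁ : 0 ≤ x₁) (hx₂ : 0 ≤ x₂)
    (hu₁ : 0 ≤ u₁) (hu₂ : 0 ≤ u₂) (hu : u₁ • w₁ + u₂ • w₂ ≠ 0) (h : 0 ≤ x₁ * u₂ - x₂ * u₁) :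
    x₁ • w₁ + x₂ • w₂ ∈ cone w₁ (u₁ • w₁ + u₂ • w₂) := by
  rcases hu₂.eq_or_lt with h0 | h0
  · subst h0
    have hu₁' : 0 < u₁ := by
      rcases hu₁.eq_or_lt with h1 | h1
      · subst h1
        simp at hu
      · exact h1
    have : x₂ = 0 := by nlinarith
    subst this
    exact ⟨x₁, 0, hx₁, le_rfl, by simp⟩
  · refine ⟨(x₁ * u₂ - x₂ * u₁) / u₂, x₂ / u₂, by positivity, by positivity, ?_⟩
    ext i
    simp
    field_simp
    ring

theorem cone_aux (w₁ u v w₂ : Fin 2 → ℝ) (hu : u ≠ 0) (hv : v ≠ 0)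
    (h2 : 0 < det2 u v) (h4 : 0 < det2 w₁ w₂)
    (huK : u ∈ cone w₁ w₂) (hvK : v ∈ cone w₁ w₂)
    (a b : Fin 2 → ℝ) (ha : a ∈ cone w₁ w₂) (hb : b ∈ cone w₁ w₂)
    (huab : u ∈ cone a b) (hvab : v ∈ cone a b) (hab : 0 ≤ det2 a b) :
    a ∈ cone w₁ u ∧ b ∈ cone v w₂ := by
  have hau : 0 ≤ det2 a u := by
    obtain ⟨p, q, hp, hq, rfl⟩ := huab
    have : det2 a (p • a + q • b) = q * det2 a b := by simp [det2]; ring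
    rw [this]; positivity
  have hvb : 0 ≤ det2 v b := by
    obtain ⟨p, q, hp, hq, rfl⟩ := hvab
    have : det2 (p • a + q • b) b = p * det2 a b := by simp [det2]; ring
    rw [this]; positivity
  have key : ∀ s t p q : ℝ, det2 (s • w₁ + t • w₂) (p • w₁ + q • w₂)
      = (s * q - t * p) * det2 w₁ w₂ := by
    intro s t p q; simp [det2]; ring
  clear huab hvab h2
  obtain ⟨u₁, u₂, hu1, hu2, rfl⟩ := huK
  obtain ⟨v₁, v₂, hv1, hv2, rfl⟩ := hvK
  obtain ⟨a₁, a₂, ha1, ha2, rfl⟩ := ha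
  obtain ⟨b₁, b₂, hb1, hb2, rfl⟩ := hb
  rw [key] at hau hvb
  have e1 := nonneg_of_mul_nonneg_left hau h4
  have e2 := nonneg_of_mul_nonneg_left hvb h4
  refine ⟨cone_coef _ _ _ _ _ _ ha1 ha2 hu1 hu2 hu e1, ?_⟩
  rw [cone_swap, add_comm (b₁ • w₁), add_comm (v₁ • w₁)]
  rw [add_comm] at hv
  exact cone_coef _ _ _ _ _ _ hb2 hb1 hv2 hv1 hv (by linarith)

theorem stmt11 (w₁ u v w₂ : Fin 2 → ℝ)
    (hw₁ : w₁ ≠ 0) (hu : u ≠ 0) (hv : v ≠ 0) (hw₂ : w₂ ≠ 0)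
    (h1 : 0 ≤ det2 w₁ u) (h2 : 0 < det2 u v) (h3 : 0 ≤ det2 v w₂) (h4 : 0 < det2 w₁ w₂)
    (huK : u ∈ cone w₁ w₂) (hvK : v ∈ cone w₁ w₂)
    (a b : Fin 2 → ℝ) (ha : a ∈ cone w₁ w₂) (hb : b ∈ cone w₁ w₂)
    (huab : u ∈ cone a b) (hvab : v ∈ cone a b) :
    (a ∈ cone w₁ u ∧ b ∈ cone v w₂) ∨ (b ∈ cone w₁ u ∧ a ∈ cone v w₂) := by
  rcases le_total 0 (det2 a b) with h | h
  · exact Or.inl (cone_aux w₁ u v w₂ hu hv h2 h4 huK hvK a b ha hb huab hvab h)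
  · right
    rw [cone_swap] at huab hvab
    refine cone_aux w₁ u v w₂ hu hv h2 h4 huK hvK b a hb ha huab hvab ?_
    unfold det2 at *
    linarith
end
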